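/- Oracle inequality for quadratic loss: let β* ∈ E and suppose γ > 0 satisfies: for every β ∈ E with β ≠ β̄ and 2⟪H(β − β̄), β − β̄⟫ + sup_{u ∈ G} ⟪u + 2Hβ* − z, β − β̄⟫ ≤ 0, one has 2⟪H(β − β̄), β − β̄⟫ ≥ γ·N(β − β̄)². Assume the function β ↦ L(β) − ⟪2Hβ̄ − 2Hβ*, β⟫ + R_G(β) attains a minimum over E. Then ⟪H(β̂ − β*), β̂ − β*⟫ + (R(β̂) − R_G(β̂)) ≤ ⟪H(β̄ − β*), β̄ − β*⟫ + (2γ)⁻¹ · (inf_{u ∈ G} N_D(u + 2Hβ* − z))². -/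

import Mathlib

open RealInnerProductSpace

/-- A function with the properties of a norm on a finite-dimensional space dominates a positive
multiple of the ambient norm. -/
theorem exists_pos_mul_norm_le {E : Type*} [NormedAddCommGroup E] [InnerProductSpace ℝ E]
    [FiniteDimensional ℝ E] {N : E → ℝ} (hNnonneg : ∀ x, 0 ≤ N x)
    (hNzero : ∀ x, N x = 0 ↔ x = 0) (hNsmul : ∀ (c : ℝ) (x : E), N (c • x) = |c| * N x)
    (hNadd : ∀ x y : E, N (x + y) ≤ N x + N y) :
    ∃ c : ℝ, 0 < c ∧ ∀ x, c * ‖x‖ ≤ N x := by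
  have hconv : ConvexOn ℝ Set.univ N := by
    refine ⟨convex_univ, fun x _ y _ a b ha hb _ => (hNadd _ _).trans_eq ?_⟩
    rw [hNsmul, hNsmul, abs_of_nonneg ha, abs_of_nonneg hb, smul_eq_mul, smul_eq_mul]
  have hcont : Continuous N := by
    simpa [continuousOn_univ] using hconv.continuousOn_interior
  rcases (Metric.sphere (0 : E) 1).eq_empty_or_nonempty with hempty | hne
  · refine ⟨1, one_pos, fun x => ?_⟩
    have hx : x = 0 := by
      by_contra hx
      have : (‖x‖⁻¹ : ℝ) • x ∈ Metric.sphere (0 : E) 1 := by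
        simp [norm_smul, hx]
      simp [hempty] at this
    simpa [hx] using hNnonneg 0
  · obtain ⟨x₀, hx₀, hle⟩ := (isCompact_sphere (0 : E) 1).exists_isMinOn hne hcont.continuousOn
    have hx₀ne : x₀ ≠ 0 := by
      rintro rfl
      simp at hx₀
    refine ⟨N x₀, lt_of_le_of_ne (hNnonneg _) fun h => hx₀ne ((hNzero _).1 h.symm), fun x => ?_⟩
    by_cases hx : x = 0
    · simpa [hx] using hNnonneg 0
    have hxpos : 0 < ‖x‖ := norm_pos_iff.2 hx
    have hmem : (‖x‖⁻¹ : ℝ) • x ∈ Metric.sphere (0 : E) 1 := by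
      simp [norm_smul, hx]
    have h : N x₀ ≤ N ((‖x‖⁻¹ : ℝ) • x) := hle hmem
    rw [hNsmul, abs_of_pos (inv_pos.2 hxpos), inv_mul_eq_div] at h
    exact (le_div_iff₀ hxpos).1 h

/-- The inequality `⟪v, x⟫ ≤ N_D(v) N(x)` between a norm and its dual norm. -/
theorem inner_le_dual_mul {E : Type*} [NormedAddCommGroup E] [InnerProductSpace ℝ E]
    [FiniteDimensional ℝ E] {N : E → ℝ} (hNnonneg : ∀ x, 0 ≤ N x)
    (hNzero : ∀ x, N x = 0 ↔ x = 0) (hNsmul : ∀ (c : ℝ) (x : E), N (c • x) = |c| * N x)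
    (hNadd : ∀ x y : E, N (x + y) ≤ N x + N y) (v x : E) :
    ⟪v, x⟫ ≤ sSup ((fun β => ⟪v, β⟫) '' {β : E | N β ≤ 1}) * N x := by
  obtain ⟨c, hc, hcN⟩ := exists_pos_mul_norm_le hNnonneg hNzero hNsmul hNadd
  have hbdd : BddAbove ((fun β => ⟪v, β⟫) '' {β : E | N β ≤ 1}) := by
    refine ⟨‖v‖ * c⁻¹, ?_⟩
    rintro _ ⟨β, hβ, rfl⟩
    refine (real_inner_le_norm v β).trans (mul_le_mul_of_nonneg_left ?_ (norm_nonneg v))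
    rw [← one_div, le_div_iff₀' hc]
    exact (hcN β).trans hβ
  by_cases hx : x = 0
  · simp [hx, (hNzero 0).2 rfl]
  have hpos : 0 < N x := lt_of_le_of_ne (hNnonneg x) fun h => hx ((hNzero x).1 h.symm)
  have hmem : (N x)⁻¹ • x ∈ {β : E | N β ≤ 1} := by
    simp [hNsmul, abs_of_pos hpos, hpos.ne']
  have h : ⟪v, (N x)⁻¹ • x⟫ ≤ _ := le_csSup hbdd ⟨_, hmem, rfl⟩
  rw [real_inner_smul_right, inv_mul_eq_div] at h
  exact (div_le_iff₀ hpos).1 h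

theorem IsCompact.bddAbove_inner_image {E : Type*} [NormedAddCommGroup E]
    [InnerProductSpace ℝ E] {G : Set E} (hG : IsCompact G) (x : E) :
    BddAbove ((fun u => ⟪u, x⟫) '' G) :=
  (hG.image (by fun_prop)).bddAbove

/-- Translating a set by `w` changes its support function by `⟪w, ·⟫`. -/
theorem IsCompact.sSup_inner_add {E : Type*} [NormedAddCommGroup E] [InnerProductSpace ℝ E]
    {G : Set E} (hG : IsCompact G) (hne : G.Nonempty) (w x : E) :
    sSup ((fun u => ⟪u + w, x⟫) '' G) = sSup ((fun u => ⟪u, x⟫) '' G) + ⟪w, x⟫ := by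
  have h := (OrderIso.addRight ⟪w, x⟫).map_csSup' (hne.image _) (hG.bddAbove_inner_image x)
  rw [Set.image_image] at h
  simpa [inner_add_left] using h.symm

/-- Support functions are positively homogeneous. -/
theorem sSup_inner_smul {E : Type*} [NormedAddCommGroup E] [InnerProductSpace ℝ E]
    (G : Set E) {t : ℝ} (ht : 0 ≤ t) (x : E) :
    sSup ((fun u => ⟪u, t • x⟫) '' G) = t * sSup ((fun u => ⟪u, x⟫) '' G) := by
  rw [← smul_eq_mul, ← Real.sSup_smul_of_nonneg ht, ← Set.image_smul, Set.image_image]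
  simp [real_inner_smul_right]

theorem nonneg_of_forall_add_mul_nonneg {a b : ℝ}
    (h : ∀ t : ℝ, 0 < t → t ≤ 1 → 0 ≤ a + t * b) : 0 ≤ a := by
  have hlim : Filter.Tendsto (fun t : ℝ => a + t * b) (nhdsWithin 0 (Set.Ioi 0)) (nhds a) := by
    have : Continuous fun t : ℝ => a + t * b := by fun_prop
    simpa using (this.tendsto 0).mono_left nhdsWithin_le_nhds
  refine ge_of_tendsto hlim ?_
  filter_upwards [Ioc_mem_nhdsGT (zero_lt_one' ℝ)] with t ht using h t ht.1 ht.2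

/-- Taylor expansion of a self-adjoint quadratic form. -/
theorem inner_map_add_smul {E : Type*} [NormedAddCommGroup E] [InnerProductSpace ℝ E]
    (H : E →ₗ[ℝ] E) (hHsa : ∀ x y : E, ⟪H x, y⟫ = ⟪x, H y⟫) (a b : E) (t : ℝ) :
    ⟪H (a + t • b), a + t • b⟫ = ⟪H a, a⟫ + 2 * t * ⟪H a, b⟫ + t ^ 2 * ⟪H b, b⟫ := by
  have h : ⟪H b, a⟫ = ⟪H a, b⟫ := by rw [hHsa, real_inner_comm]
  simp only [map_add, map_smul, inner_add_left, inner_add_right, real_inner_smul_left,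
    real_inner_smul_right, h]
  ring

/-- A minimizer of a quadratic loss plus a convex penalty over a convex set has objective value
smaller than that of any competitor by at least the Bregman divergence of the loss. -/
theorem quadratic_add_convex_bregman_le {E : Type*} [NormedAddCommGroup E]
    [InnerProductSpace ℝ E] (H : E →ₗ[ℝ] E) (z : E) (hHsa : ∀ x y : E, ⟪H x, y⟫ = ⟪x, H y⟫)
    {R : E → ℝ} (hR : ConvexOn ℝ Set.univ R) {Ω : Set E} (hΩ : Convex ℝ Ω) {x y : E}
    (hx : x ∈ Ω) (hy : y ∈ Ω)
    (hmin : ∀ β ∈ Ω, ⟪H x - z, x⟫ + R x ≤ ⟪H β - z, β⟫ + R β) :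
    ⟪H x - z, x⟫ + R x + ⟪H (y - x), y - x⟫ ≤ ⟪H y - z, y⟫ + R y := by
  have key (t : ℝ) : ⟪H (x + t • (y - x)) - z, x + t • (y - x)⟫ =
      ⟪H x - z, x⟫ + t * (2 * ⟪H x, y - x⟫ - ⟪z, y - x⟫) + t ^ 2 * ⟪H (y - x), y - x⟫ := by
    rw [inner_sub_left, inner_map_add_smul H hHsa, inner_sub_left, inner_add_right,
      real_inner_smul_right]
    ring
  have hfirst : 0 ≤ 2 * ⟪H x, y - x⟫ - ⟪z, y - x⟫ + R y - R x := by
    refine nonneg_of_forall_add_mul_nonneg (b := ⟪H (y - x), y - x⟫) fun t ht ht1 => ?_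
    have h := hmin _ (hΩ.add_smul_sub_mem hx hy ⟨ht.le, ht1⟩)
    have hc := hR.2 (Set.mem_univ x) (Set.mem_univ y) (sub_nonneg.2 ht1) ht.le (by ring)
    have he : (1 - t) • x + t • y = x + t • (y - x) := by module
    rw [he, smul_eq_mul, smul_eq_mul] at hc
    rw [key] at h
    refine nonneg_of_mul_nonneg_right (a := t) ?_ ht
    linarith
  have h1 := key 1
  rw [one_smul, add_sub_cancel] at h1
  linarith

/-- Corollary `cor:recovery-global-dc-quadratic`, oracle inequality for quadratic
loss `L(β) = ⟪Hβ − z, β⟫`: under the quadratic restricted strong convexity property with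
constant `γ > 0`, and assuming `β ↦ L(β) − ⟪2Hβ̄ − 2Hβ*, β⟫ + R_G(β)` attains a minimum
over `E`, one has
`⟪H(β̂ − β*), β̂ − β*⟫ + (R(β̂) − R_G(β̂))
  ≤ ⟪H(β̄ − β*), β̄ − β*⟫ + (2γ)⁻¹·(inf_{u ∈ G} N_D(u + 2Hβ* − z))²`. -/
theorem stmt8
    {E : Type*} [NormedAddCommGroup E] [InnerProductSpace ℝ E] [FiniteDimensional ℝ E]
    (H : E →ₗ[ℝ] E) (z : E)
    (hHsa : ∀ x y : E, ⟪H x, y⟫ = ⟪x, H y⟫)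
    (hHpsd : ∀ x : E, 0 ≤ ⟪H x, x⟫)
    (R : E → ℝ) (hRconv : ConvexOn ℝ Set.univ R)
    (Ω : Set E) (hΩ : Convex ℝ Ω)
    (βhat : E) (hβhatΩ : βhat ∈ Ω)
    (hmin : ∀ β ∈ Ω, ⟪H βhat - z, βhat⟫ + R βhat ≤ ⟪H β - z, β⟫ + R β)
    (βbar : E) (hβbarΩ : βbar ∈ Ω)
    (G : Set E) (hGne : G.Nonempty) (hGcp : IsCompact G) (hGcv : Convex ℝ G)
    (hGsub : ∀ v ∈ G, ∀ y : E, R βbar + ⟪v, y - βbar⟫ ≤ R y)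
    (N : E → ℝ)
    (hNnonneg : ∀ x, 0 ≤ N x) (hNzero : ∀ x, N x = 0 ↔ x = 0)
    (hNsmul : ∀ (c : ℝ) (x : E), N (c • x) = |c| * N x)
    (hNadd : ∀ x y : E, N (x + y) ≤ N x + N y)
    (βstar : E) (γ : ℝ) (hγ : 0 < γ)
    (hRSC : ∀ β : E, β ≠ βbar →
      2 * ⟪H (β - βbar), β - βbar⟫
          + sSup ((fun u => ⟪u + ((2 : ℝ) • H βstar - z), β - βbar⟫) '' G) ≤ 0 →
      γ * N (β - βbar) ^ 2 ≤ 2 * ⟪H (β - βbar), β - βbar⟫)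
    (hattain : ∃ Q : E, ∀ β : E,
      (⟪H Q - z, Q⟫ - ⟪(2 : ℝ) • H βbar - (2 : ℝ) • H βstar, Q⟫)
          + (R βbar + sSup ((fun u => ⟪u, Q - βbar⟫) '' G))
        ≤ (⟪H β - z, β⟫ - ⟪(2 : ℝ) • H βbar - (2 : ℝ) • H βstar, β⟫)
          + (R βbar + sSup ((fun u => ⟪u, β - βbar⟫) '' G))) :
    ⟪H (βhat - βstar), βhat - βstar⟫
      + (R βhat - (R βbar + sSup ((fun u => ⟪u, βhat - βbar⟫) '' G)))
      ≤ ⟪H (βbar - βstar), βbar - βstar⟫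
        + (2 * γ)⁻¹ *
          (sInf ((fun u => sSup ((fun β => ⟪u + ((2 : ℝ) • H βstar - z), β⟫)
            '' {β : E | N β ≤ 1})) '' G)) ^ 2 := by
  set w : E := (2 : ℝ) • H βstar - z with hw
  let q : E → ℝ := fun x => ⟪H x, x⟫
  let S : E → ℝ := fun x => sSup ((fun u => ⟪u, x⟫) '' G)
  let ND : E → ℝ := fun u => sSup ((fun β => ⟪u + w, β⟫) '' {β : E | N β ≤ 1})
  have hT (x : E) : sSup ((fun u => ⟪u + w, x⟫) '' G) = S x + ⟪w, x⟫ :=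
    hGcp.sSup_inner_add hGne w x
  have hq_add (a b : E) : q (a + b) = q a + 2 * ⟪H a, b⟫ + q b := by
    simpa [q] using inner_map_add_smul H hHsa a b 1
  have hw_inner (x : E) : ⟪w, x⟫ = 2 * ⟪H βstar, x⟫ - ⟪z, x⟫ := by
    rw [hw, inner_sub_left, real_inner_smul_left]
  obtain ⟨Q, hQ⟩ := hattain
  -- The attained objective, recentred at `βbar`, is `q x + S x + ⟪w, x⟫`.
  have hshift (x : E) :
      ⟪H (βbar + x) - z, βbar + x⟫ - ⟪(2 : ℝ) • H βbar - (2 : ℝ) • H βstar, βbar + x⟫ =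
        (⟪H βbar - z, βbar⟫ - ⟪(2 : ℝ) • H βbar - (2 : ℝ) • H βstar, βbar⟫) +
          (q x + ⟪w, x⟫) := by
    have h := hq_add βbar x
    simp only [q] at h ⊢
    rw [hw_inner, inner_sub_left, h]
    simp only [inner_sub_left, inner_add_right, real_inner_smul_left]
    ring
  obtain ⟨x, rfl⟩ : ∃ x, Q = βbar + x := ⟨Q - βbar, by abel⟩
  have hx (y : E) : q x + S x + ⟪w, x⟫ ≤ q y + S y + ⟪w, y⟫ := by
    have h := hQ (βbar + y)
    rw [hshift, hshift, add_sub_cancel_left, add_sub_cancel_left] at h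
    simp only [S]
    linarith
  have hscale (t : ℝ) (ht : 0 ≤ t) :
      q x + S x + ⟪w, x⟫ ≤ t ^ 2 * q x + t * (S x + ⟪w, x⟫) := by
    have h := hx (t • x)
    have hqt : q (t • x) = t ^ 2 * q x := by
      simp only [q, map_smul, real_inner_smul_left, real_inner_smul_right]
      ring
    have hSt : S (t • x) = t * S x := sSup_inner_smul G ht x
    rw [hqt, hSt, real_inner_smul_right] at h
    linarith
  have hstat : 2 * q x + (S x + ⟪w, x⟫) ≤ 0 := by
    have h : 0 ≤ -(2 * q x + (S x + ⟪w, x⟫)) := by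
      refine nonneg_of_forall_add_mul_nonneg (b := q x) fun t ht ht1 => ?_
      refine nonneg_of_mul_nonneg_right (a := t) ?_ ht
      linarith [hscale (1 - t) (sub_nonneg.2 ht1)]
    linarith
  have hmain : -(q x + S x + ⟪w, x⟫) ≤ (2 * γ)⁻¹ * (sInf (ND '' G)) ^ 2 := by
    by_cases hx0 : x = 0
    · have h0 : q x + S x + ⟪w, x⟫ = 0 := by
        simp [hx0, q, S, hGne.image_const]
      rw [h0, neg_zero]
      positivity
    have hrsc : γ * N x ^ 2 ≤ 2 * q x := by
      have h := hRSC (βbar + x) (by simpa using hx0)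
      rw [add_sub_cancel_left, hT] at h
      exact h hstat
    have hNpos : 0 < N x := lt_of_le_of_ne (hNnonneg x) fun h => hx0 ((hNzero x).1 h.symm)
    have hdual : -(S x + ⟪w, x⟫) ≤ sInf (ND '' G) * N x := by
      rw [← div_le_iff₀ hNpos]
      refine le_csInf (hGne.image _) ?_
      rintro _ ⟨u, hu, rfl⟩
      rw [div_le_iff₀ hNpos]
      have h1 := inner_le_dual_mul hNnonneg hNzero hNsmul hNadd (u + w) (-x)
      have h2 : N (-x) = N x := by simpa using hNsmul (-1) x
      have h3 : ⟪u, x⟫ ≤ S x := le_csSup (hGcp.bddAbove_inner_image x) ⟨u, hu, rfl⟩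
      rw [h2, inner_neg_right, inner_add_left] at h1
      simp only [ND]
      linarith
    rw [inv_mul_eq_div, le_div_iff₀ (by positivity)]
    nlinarith [sq_nonneg (sInf (ND '' G) - γ * N x)]
  have hbreg := quadratic_add_convex_bregman_le H z hHsa hRconv hΩ hβhatΩ hβbarΩ hmin
  obtain ⟨h, rfl⟩ : ∃ h, βhat = βbar + h := ⟨βhat - βbar, by abel⟩
  have hneg : ⟪H (βbar - (βbar + h)), βbar - (βbar + h)⟫ = q h := by
    simp [q]
  have hloss := hshift h
  have herr : ⟪H (βbar + h - βstar), βbar + h - βstar⟫ =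
      q (βbar - βstar) + 2 * ⟪H (βbar - βstar), h⟫ + q h := by
    rw [add_sub_right_comm]
    exact hq_add _ _
  rw [hneg] at hbreg
  have hlin : ⟪(2 : ℝ) • H βbar - (2 : ℝ) • H βstar, βbar + h⟫ =
      ⟪(2 : ℝ) • H βbar - (2 : ℝ) • H βstar, βbar⟫ + 2 * ⟪H (βbar - βstar), h⟫ := by
    simp only [inner_add_right, ← smul_sub, ← map_sub, real_inner_smul_left]
  rw [herr, add_sub_cancel_left]
  change _ + (_ - (_ + S h)) ≤ q (βbar - βstar) + (2 * γ)⁻¹ * (sInf (ND '' G)) ^ 2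
  linarith [hx h]
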